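/- arXiv:1911.04436 — 5 statements merged into one kernel-verified Lean document; each statement's English description precedes it below -/
import Mathlib

section
/- Let d, r be positive integers, u_1, …, u_r ∈ ℝ^d nonzero vectors, μ ≥ 1, and T⋆ = Σ_{i=1}^r u_i^{⊗3}. Assume the pairwise incoherence condition d⟨u_i, u_j⟩² ≤ μ‖u_i‖₂²‖u_j‖₂² for all i ≠ j, and assume r·√(μ/d) ≤ λ_min⋆²/(2·λ_max⋆²). Then (r/2)·λ_min⋆² ≤ ‖T⋆‖_F² ≤ 2r·λ_max⋆². -/
open MeasureTheory ProbabilityTheory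

noncomputable section

/-- Euclidean (ℓ₂) norm of a vector in ℝ^d. -/
def l2norm {d : ℕ} (u : Fin d → ℝ) : ℝ := Real.sqrt (∑ j, u j ^ 2)

/-- ℓ∞ norm of a vector in ℝ^d. -/
def linfnorm {d : ℕ} (u : Fin d → ℝ) : ℝ := ⨆ j, |u j|

/-- Euclidean inner product on ℝ^d. -/
def inp {d : ℕ} (u v : Fin d → ℝ) : ℝ := ∑ j, u j * v j

/-- The symmetric tensor T⋆ = Σᵢ uᵢ^{⊗3}, with entries T⋆_{j,k,l} = Σᵢ (uᵢ)_j (uᵢ)_k (uᵢ)_l. -/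
def Tstar {d r : ℕ} (u : Fin r → Fin d → ℝ) : Fin d → Fin d → Fin d → ℝ :=
  fun j k l => ∑ i, u i j * u i k * u i l

/-- Frobenius norm of a d×d×d tensor. -/
def frobT {d : ℕ} (T : Fin d → Fin d → Fin d → ℝ) : ℝ :=
  Real.sqrt (∑ j, ∑ k, ∑ l, T j k l ^ 2)

/-- ℓ∞ (entrywise max) norm of a d×d×d tensor. -/
def tinf {d : ℕ} (T : Fin d → Fin d → Fin d → ℝ) : ℝ := ⨆ j, ⨆ k, ⨆ l, |T j k l|

/-- λ_max⋆ = maxᵢ ‖uᵢ‖₂³. -/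
def lamMax {d r : ℕ} (u : Fin r → Fin d → ℝ) : ℝ := ⨆ i, l2norm (u i) ^ 3

/-- λ_min⋆ = minᵢ ‖uᵢ‖₂³. -/
def lamMin {d r : ℕ} (u : Fin r → Fin d → ℝ) : ℝ := ⨅ i, l2norm (u i) ^ 3

/-- Frobenius norm of the d×r matrix whose i-th column is u i. -/
def frobM {d r : ℕ} (U : Fin r → Fin d → ℝ) : ℝ :=
  Real.sqrt (∑ i, ∑ j, U i j ^ 2)

/-- ‖·‖_{2,∞}: maximum ℓ₂ norm of the rows of the d×r matrix whose i-th column is u i. -/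
def m2inf {d r : ℕ} (U : Fin r → Fin d → ℝ) : ℝ :=
  ⨆ j : Fin d, Real.sqrt (∑ i, U i j ^ 2)

/-- Tensor operator norm: sup of ⟨T, a⊗b⊗c⟩ over unit vectors a, b, c. -/
def topNorm {d : ℕ} (T : Fin d → Fin d → Fin d → ℝ) : ℝ :=
  sSup {x : ℝ | ∃ a b c : Fin d → ℝ,
    l2norm a = 1 ∧ l2norm b = 1 ∧ l2norm c = 1 ∧
    x = ∑ j, ∑ k, ∑ l, T j k l * a j * b k * c l}

/-- Matrix spectral (ℓ₂→ℓ₂ operator) norm: sup of ‖Mv‖₂ over unit vectors v. -/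
def specNorm {m n : ℕ} (M : Matrix (Fin m) (Fin n) ℝ) : ℝ :=
  sSup {x : ℝ | ∃ v : Fin n → ℝ, l2norm v = 1 ∧ x = l2norm (M.mulVec v)}

end

theorem frob_expand {d r : ℕ} (u : Fin r → Fin d → ℝ) :
    frobT (Tstar u) ^ 2 = ∑ i, ∑ j, inp (u i) (u j) ^ 3 := by
  unfold frobT
  rw [Real.sq_sqrt (by positivity)]
  unfold Tstar inp
  have h1 : ∀ i j : Fin r, (∑ a, u i a * u j a) ^ 3
      = ∑ a, ∑ b, ∑ c, (u i a * u i b * u i c) * (u j a * u j b * u j c) := by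
    intro i j
    rw [pow_succ, pow_two, Finset.sum_mul_sum, Finset.sum_mul]
    refine Finset.sum_congr rfl fun a _ => ?_
    rw [Finset.sum_mul]
    refine Finset.sum_congr rfl fun b _ => ?_
    rw [Finset.mul_sum]
    refine Finset.sum_congr rfl fun c _ => ?_
    ring
  simp_rw [h1, pow_two, Finset.sum_mul_sum]
  symm
  calc _ = ∑ i, ∑ a, ∑ j, ∑ b, ∑ c, (u i a * u i b * u i c) * (u j a * u j b * u j c) := by
        refine Finset.sum_congr rfl fun i _ => Finset.sum_comm
    _ = ∑ a, ∑ i, ∑ j, ∑ b, ∑ c, (u i a * u i b * u i c) * (u j a * u j b * u j c) :=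
        Finset.sum_comm
    _ = ∑ a, ∑ i, ∑ b, ∑ j, ∑ c, (u i a * u i b * u i c) * (u j a * u j b * u j c) := by
        refine Finset.sum_congr rfl fun a _ => Finset.sum_congr rfl fun i _ => Finset.sum_comm
    _ = ∑ a, ∑ b, ∑ i, ∑ j, ∑ c, (u i a * u i b * u i c) * (u j a * u j b * u j c) := by
        refine Finset.sum_congr rfl fun a _ => Finset.sum_comm
    _ = ∑ a, ∑ b, ∑ i, ∑ c, ∑ j, (u i a * u i b * u i c) * (u j a * u j b * u j c) := by
        refine Finset.sum_congr rfl fun a _ => Finset.sum_congr rfl fun b _ =>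
          Finset.sum_congr rfl fun i _ => Finset.sum_comm
    _ = _ := by
        refine Finset.sum_congr rfl fun a _ => Finset.sum_congr rfl fun b _ => Finset.sum_comm

/-- Under pairwise incoherence and r√(μ/d) ≤ λ_min⋆²/(2λ_max⋆²),
the Frobenius norm of T⋆ = Σᵢ uᵢ^{⊗3} satisfies (r/2)λ_min⋆² ≤ ‖T⋆‖_F² ≤ 2r λ_max⋆². -/
theorem stmt0 (d r : ℕ) (hd : 0 < d) (hr : 0 < r)
    (u : Fin r → Fin d → ℝ) (hu : ∀ i, u i ≠ 0)
    (μ : ℝ) (hμ : 1 ≤ μ)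
    (hincoh : ∀ i j : Fin r, i ≠ j →
      (d : ℝ) * inp (u i) (u j) ^ 2 ≤ μ * l2norm (u i) ^ 2 * l2norm (u j) ^ 2)
    (hrank : (r : ℝ) * Real.sqrt (μ / d) ≤ lamMin u ^ 2 / (2 * lamMax u ^ 2)) :
    (r : ℝ) / 2 * lamMin u ^ 2 ≤ frobT (Tstar u) ^ 2 ∧
      frobT (Tstar u) ^ 2 ≤ 2 * (r : ℝ) * lamMax u ^ 2 := by
  rw [frob_expand]
  have hd' : (0 : ℝ) < d := by exact_mod_cast hd
  have hr' : (1 : ℝ) ≤ r := by exact_mod_cast hr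
  haveI : Nonempty (Fin r) := ⟨⟨0, hr⟩⟩
  have hn0 : ∀ i, 0 ≤ l2norm (u i) := fun i => Real.sqrt_nonneg _
  have hself : ∀ i, inp (u i) (u i) = l2norm (u i) ^ 2 := by
    intro i
    unfold inp l2norm
    rw [Real.sq_sqrt (by positivity)]
    exact Finset.sum_congr rfl fun a _ => (pow_two _).symm
  have hM : ∀ i, l2norm (u i) ^ 3 ≤ lamMax u := fun i =>
    le_ciSup (f := fun i => l2norm (u i) ^ 3) (Set.finite_range _).bddAbove i
  have hm : ∀ i, lamMin u ≤ l2norm (u i) ^ 3 := fun i =>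
    ciInf_le (f := fun i => l2norm (u i) ^ 3) (Set.finite_range _).bddBelow i
  have hm0 : 0 ≤ lamMin u := le_ciInf fun i => pow_nonneg (hn0 i) 3
  have hpos : ∀ i, 0 < l2norm (u i) := by
    intro i
    apply Real.sqrt_pos.2
    obtain ⟨a, ha⟩ := Function.ne_iff.1 (hu i)
    have ha' : u i a ≠ 0 := ha
    exact Finset.sum_pos' (fun _ _ => sq_nonneg _) ⟨a, Finset.mem_univ _, by positivity⟩
  have i0 : Fin r := ⟨0, hr⟩
  have hM0 : 0 < lamMax u := lt_of_lt_of_le (pow_pos (hpos i0) 3) (hM i0)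
  have hmM : lamMin u ≤ lamMax u := (hm i0).trans (hM i0)
  generalize lamMax u = M at *
  generalize lamMin u = m at *
  have hs0 : 0 ≤ Real.sqrt (μ / d) := Real.sqrt_nonneg _
  have hs2 : Real.sqrt (μ / d) ^ 2 = μ / d := Real.sq_sqrt (by positivity)
  generalize Real.sqrt (μ / d) = s at *
  rw [le_div_iff₀ (by positivity)] at hrank
  have hmM2 : m ^ 2 ≤ M ^ 2 := pow_le_pow_left₀ hm0 hmM 2
  have hs1 : s ≤ 1 := by
    have h1 : s * M ^ 2 ≤ r * s * M ^ 2 := by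
      have : 0 ≤ s * M ^ 2 := by positivity
      nlinarith
    have h2 : 0 < M ^ 2 := by positivity
    nlinarith
  have hkey : ∀ i j, |inp (u i) (u j) ^ 3 - (if i = j then (l2norm (u i) ^ 3) ^ 2 else 0)|
      ≤ s * M ^ 2 := by
    intro i j
    split_ifs with h
    · subst h
      rw [hself, show (l2norm (u i) ^ 2) ^ 3 - (l2norm (u i) ^ 3) ^ 2 = 0 by ring, abs_zero]
      positivity
    · have h1 := hincoh i j h
      have h2 : |inp (u i) (u j)| ≤ s * l2norm (u i) * l2norm (u j) := by
        apply abs_le_of_sq_le_sq _ (by have := hn0 i; have := hn0 j; positivity)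
        rw [mul_pow, mul_pow, hs2, div_mul_eq_mul_div, div_mul_eq_mul_div, le_div_iff₀ hd']
        linarith
      rw [sub_zero, abs_pow]
      calc |inp (u i) (u j)| ^ 3 ≤ (s * l2norm (u i) * l2norm (u j)) ^ 3 :=
            pow_le_pow_left₀ (abs_nonneg _) h2 3
        _ = s ^ 3 * (l2norm (u i) ^ 3 * l2norm (u j) ^ 3) := by ring
        _ ≤ s * (M * M) := by
            apply mul_le_mul _ _ (by have := hn0 i; have := hn0 j; positivity) hs0
            · exact pow_le_of_le_one hs0 hs1 (by norm_num)
            · exact mul_le_mul (hM i) (hM j) (pow_nonneg (hn0 j) 3) hM0.le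
        _ = s * M ^ 2 := by ring
  have hsum : |(∑ i, ∑ j, inp (u i) (u j) ^ 3) - ∑ i, (l2norm (u i) ^ 3) ^ 2|
      ≤ r * (r * (s * M ^ 2)) := by
    have e : (∑ i, ∑ j, inp (u i) (u j) ^ 3) - ∑ i, (l2norm (u i) ^ 3) ^ 2
        = ∑ i, ∑ j, (inp (u i) (u j) ^ 3 - (if i = j then (l2norm (u i) ^ 3) ^ 2 else 0)) := by
      simp [Finset.sum_sub_distrib]
    rw [e]
    refine (Finset.abs_sum_le_sum_abs _ _).trans ?_
    calc _ ≤ ∑ i : Fin r, ∑ j : Fin r, s * M ^ 2 :=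
          Finset.sum_le_sum fun i _ => (Finset.abs_sum_le_sum_abs _ _).trans
            (Finset.sum_le_sum fun j _ => hkey i j)
      _ = _ := by simp
  have hlo : r * m ^ 2 ≤ ∑ i, (l2norm (u i) ^ 3) ^ 2 := by
    calc (r : ℝ) * m ^ 2 = ∑ i : Fin r, m ^ 2 := by simp
      _ ≤ _ := Finset.sum_le_sum fun i _ => pow_le_pow_left₀ hm0 (hm i) 2
  have hhi : ∑ i, (l2norm (u i) ^ 3) ^ 2 ≤ r * M ^ 2 := by
    calc _ ≤ ∑ i : Fin r, M ^ 2 :=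
          Finset.sum_le_sum fun i _ => pow_le_pow_left₀ (pow_nonneg (hn0 i) 3) (hM i) 2
      _ = (r : ℝ) * M ^ 2 := by simp
  have hb : (r : ℝ) * (r * (s * M ^ 2)) ≤ r * (m ^ 2 / 2) := by
    apply mul_le_mul_of_nonneg_left _ (by positivity)
    linarith
  have hrm : (r : ℝ) * m ^ 2 ≤ r * M ^ 2 := mul_le_mul_of_nonneg_left hmM2 (by positivity)
  have hrM : (0 : ℝ) ≤ r * M ^ 2 := by positivity
  have := abs_le.1 hsum
  constructor <;> linarith [this.1, this.2]
end

section
/- Let d, r be positive integers, u_1, …, u_r ∈ ℝ^d nonzero vectors, μ ≥ 1, and T⋆ = Σ_{i=1}^r u_i^{⊗3}. Assume d³‖T⋆‖_∞² ≤ μ‖T⋆‖_F², the pairwise incoherence condition d⟨u_i, u_j⟩² ≤ μ‖u_i‖₂²‖u_j‖₂² for all i ≠ j, and r·√(μ/d) ≤ λ_min⋆²/(2·λ_max⋆²). Then ‖T⋆‖_∞ ≤ √(2μr)·λ_max⋆ / d^{3/2}. -/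
open MeasureTheory ProbabilityTheory

lemma frob_sq {d r : ℕ} (u : Fin r → Fin d → ℝ) :
    frobT (Tstar u) ^ 2 = ∑ i, ∑ i', inp (u i) (u i') ^ 3 := by
  unfold frobT Tstar inp
  rw [Real.sq_sqrt (by positivity)]
  have h1 : ∀ i i' : Fin r, (∑ j, u i j * u i' j) ^ 3
      = ∑ j, ∑ k, ∑ l, (u i j * u i k * u i l) * (u i' j * u i' k * u i' l) := by
    intro i i'
    rw [pow_succ, pow_two, Finset.sum_mul_sum, Finset.sum_mul]
    refine Finset.sum_congr rfl fun j _ => ?_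
    rw [Finset.sum_mul_sum]
    refine Finset.sum_congr rfl fun k _ => Finset.sum_congr rfl fun l _ => ?_
    ring
  simp_rw [h1, pow_two, Finset.sum_mul_sum]
  have h2 : ∀ F : Fin d → Fin r → Fin r → ℝ,
      ∑ l, ∑ i, ∑ i', F l i i' = ∑ i, ∑ i', ∑ l, F l i i' := by
    intro F
    rw [Finset.sum_comm]
    refine Finset.sum_congr rfl fun i _ => ?_
    rw [Finset.sum_comm]
  simp_rw [h2]

theorem stmt1 (d r : ℕ) (hd : 0 < d) (hr : 0 < r)
    (u : Fin r → Fin d → ℝ) (hu : ∀ i, u i ≠ 0)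
    (μ : ℝ) (hμ : 1 ≤ μ)
    (hinf : (d : ℝ) ^ 3 * tinf (Tstar u) ^ 2 ≤ μ * frobT (Tstar u) ^ 2)
    (hincoh : ∀ i j : Fin r, i ≠ j →
      (d : ℝ) * inp (u i) (u j) ^ 2 ≤ μ * l2norm (u i) ^ 2 * l2norm (u j) ^ 2)
    (hrank : (r : ℝ) * Real.sqrt (μ / d) ≤ lamMin u ^ 2 / (2 * lamMax u ^ 2)) :
    tinf (Tstar u) ≤ Real.sqrt (2 * μ * r) * lamMax u / (d : ℝ) ^ ((3 : ℝ) / 2) := by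
  have hn0 : ∀ i, 0 ≤ l2norm (u i) := fun i => Real.sqrt_nonneg _
  have hmax : ∀ i, l2norm (u i) ^ 3 ≤ lamMax u := fun i =>
    le_ciSup (f := fun i => l2norm (u i) ^ 3) (Set.finite_range _).bddAbove i
  have hmin : ∀ i, lamMin u ≤ l2norm (u i) ^ 3 := fun i =>
    ciInf_le (f := fun i => l2norm (u i) ^ 3) (Set.finite_range _).bddBelow i
  haveI : Nonempty (Fin r) := ⟨⟨0, hr⟩⟩
  have hmin0 : 0 ≤ lamMin u := le_ciInf fun i => pow_nonneg (hn0 i) 3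
  have hmm : lamMin u ≤ lamMax u := (hmin ⟨0, hr⟩).trans (hmax _)
  have hL0 : 0 ≤ lamMax u := hmin0.trans hmm
  have hd' : (0 : ℝ) < d := by exact_mod_cast hd
  have hr' : (1 : ℝ) ≤ r := by exact_mod_cast hr
  set s := Real.sqrt (μ / d) with hs
  have hs0 : 0 ≤ s := Real.sqrt_nonneg _
  have hs2 : s ^ 2 = μ / d := Real.sq_sqrt (by positivity)
  have hrs : (r : ℝ) * s ≤ 1 := by
    refine hrank.trans (div_le_one_of_le₀ ?_ (by positivity))
    nlinarith
  have hs1 : s ≤ 1 := by nlinarith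
  set L := lamMax u with hL
  have hprod : ∀ i j, l2norm (u i) ^ 3 * l2norm (u j) ^ 3 ≤ L ^ 2 := by
    intro i j
    rw [pow_two]
    exact mul_le_mul (hmax i) (hmax j) (pow_nonneg (hn0 j) 3) hL0
  have hterm : ∀ i j, inp (u i) (u j) ^ 3 ≤ (if i = j then L ^ 2 else 0) + s * L ^ 2 := by
    intro i j
    by_cases h : i = j
    · subst h
      have : inp (u i) (u i) = l2norm (u i) ^ 2 := by
        unfold inp l2norm
        rw [Real.sq_sqrt (by positivity)]
        exact Finset.sum_congr rfl fun _ _ => (pow_two _).symm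
      rw [this, if_pos rfl]
      have := hprod i i
      have h3 : 0 ≤ s * L ^ 2 := by positivity
      nlinarith
    · rw [if_neg h, zero_add]
      have h1 := hincoh i j h
      have h2 : inp (u i) (u j) ^ 2 ≤ (s * (l2norm (u i) * l2norm (u j))) ^ 2 := by
        rw [mul_pow, hs2, div_mul_eq_mul_div, le_div_iff₀ hd']
        linarith
      have h3 : inp (u i) (u j) ≤ s * (l2norm (u i) * l2norm (u j)) :=
        le_of_abs_le (abs_le_of_sq_le_sq h2 (mul_nonneg hs0 (mul_nonneg (hn0 i) (hn0 j))))
      have h4 : inp (u i) (u j) ^ 3 ≤ (s * (l2norm (u i) * l2norm (u j))) ^ 3 :=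
        (Odd.strictMono_pow (by decide : Odd 3)).monotone h3
      refine h4.trans ?_
      rw [mul_pow, mul_pow]
      exact mul_le_mul (pow_le_of_le_one hs0 hs1 (by norm_num)) (hprod i j)
        (mul_nonneg (pow_nonneg (hn0 i) 3) (pow_nonneg (hn0 j) 3)) hs0
  have hF : frobT (Tstar u) ^ 2 ≤ 2 * r * L ^ 2 := by
    rw [frob_sq]
    calc _ ≤ ∑ i : Fin r, ∑ j : Fin r, ((if i = j then L ^ 2 else 0) + s * L ^ 2) :=
          Finset.sum_le_sum fun i _ => Finset.sum_le_sum fun j _ => hterm i j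
      _ = r * L ^ 2 + r * (r * s) * L ^ 2 := by
          simp [Finset.sum_add_distrib]; ring
      _ ≤ r * L ^ 2 + r * 1 * L ^ 2 := by gcongr
      _ = _ := by ring
  have hD : ((d : ℝ) ^ ((3 : ℝ) / 2)) ^ 2 = (d : ℝ) ^ 3 := by
    rw [← Real.rpow_natCast, ← Real.rpow_mul hd'.le, ← Real.rpow_natCast]
    norm_num
  have hD0 : 0 < (d : ℝ) ^ ((3 : ℝ) / 2) := Real.rpow_pos_of_pos hd' _
  rw [le_div_iff₀ hD0]
  refine le_of_abs_le (abs_le_of_sq_le_sq ?_ (mul_nonneg (Real.sqrt_nonneg _) hL0))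
  rw [mul_pow, mul_pow, hD, Real.sq_sqrt (by positivity)]
  nlinarith [mul_le_mul_of_nonneg_left hF (by linarith : 0 ≤ μ)]
end

section
/- Let d, r be positive integers, u_1, …, u_r ∈ ℝ^d, μ ≥ 1, and T⋆ = Σ_{i=1}^r u_i^{⊗3}. Assume d‖u_i‖_∞² ≤ μ‖u_i‖₂² for every i, d⟨u_i, u_j⟩² ≤ μ‖u_i‖₂²‖u_j‖₂² for all i ≠ j, and μr ≤ d. Then for every index j ∈ {1, …, d}, the j-th mode-1 slice satisfies Σ_{k,l=1}^d (T⋆_{j,k,l})² ≤ 2μr·λ_max⋆²/d. -/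
open MeasureTheory ProbabilityTheory

/-- Under the incoherence assumptions and μr ≤ d, every mode-1 slice of
T⋆ = Σᵢ uᵢ^{⊗3} has squared Frobenius norm at most 2μr·λ_max⋆²/d. -/
theorem stmt2 (d r : ℕ) (hd : 0 < d) (hr : 0 < r)
    (u : Fin r → Fin d → ℝ)
    (μ : ℝ) (hμ : 1 ≤ μ)
    (hincoh1 : ∀ i, (d : ℝ) * linfnorm (u i) ^ 2 ≤ μ * l2norm (u i) ^ 2)
    (hincoh2 : ∀ i j : Fin r, i ≠ j →
      (d : ℝ) * inp (u i) (u j) ^ 2 ≤ μ * l2norm (u i) ^ 2 * l2norm (u j) ^ 2)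
    (hμr : μ * r ≤ d) :
    ∀ j : Fin d, ∑ k, ∑ l, Tstar u j k l ^ 2 ≤ 2 * μ * r * lamMax u ^ 2 / d := by
  intro j
  have hd' : (0:ℝ) < d := by exact_mod_cast hd
  have hr' : (0:ℝ) < r := by exact_mod_cast hr
  obtain ⟨c, hc0, hc⟩ : ∃ c : ℝ, 0 ≤ c ∧ c ^ 2 * d = μ := by
    refine ⟨Real.sqrt (μ / d), Real.sqrt_nonneg _, ?_⟩
    rw [Real.sq_sqrt (by positivity)]
    field_simp
  have hs0 : ∀ i, 0 ≤ l2norm (u i) := fun i => Real.sqrt_nonneg _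
  have hL : ∀ i, l2norm (u i) ^ 3 ≤ lamMax u := fun i =>
    le_ciSup (f := fun i => l2norm (u i) ^ 3) (Set.finite_range _).bddAbove i
  have hss : ∀ i, inp (u i) (u i) = l2norm (u i) ^ 2 := by
    intro i
    unfold l2norm inp
    rw [Real.sq_sqrt (Finset.sum_nonneg fun _ _ => sq_nonneg _)]
    exact Finset.sum_congr rfl fun _ _ => by ring
  have hL0 : 0 ≤ lamMax u := le_trans (pow_nonneg (hs0 ⟨0, hr⟩) 3) (hL ⟨0, hr⟩)
  have hu : ∀ i, |u i j| ≤ c * l2norm (u i) := by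
    intro i
    have h1 : |u i j| ≤ linfnorm (u i) :=
      le_ciSup (f := fun j => |u i j|) (Set.finite_range _).bddAbove j
    refine h1.trans (abs_le_of_sq_le_sq' ?_ (mul_nonneg hc0 (hs0 i))).2
    have h2 := hincoh1 i
    rw [← hc] at h2
    refine le_of_mul_le_mul_left ?_ hd'
    linarith
  have hsum : ∑ k, ∑ l, Tstar u j k l ^ 2
      = ∑ a, ∑ b, u a j * u b j * inp (u a) (u b) ^ 2 := by
    have e : ∀ k l, Tstar u j k l ^ 2
        = ∑ a, ∑ b, u a j * u b j * ((u a k * u b k) * (u a l * u b l)) := by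
      intro k l
      unfold Tstar
      rw [sq, Finset.sum_mul_sum]
      exact Finset.sum_congr rfl fun _ _ => Finset.sum_congr rfl fun _ _ => by ring
    simp_rw [e]
    have e2 : ∀ a b, u a j * u b j * inp (u a) (u b) ^ 2
        = ∑ k, ∑ l, u a j * u b j * ((u a k * u b k) * (u a l * u b l)) := by
      intro a b
      unfold inp
      rw [sq, Finset.sum_mul_sum, Finset.mul_sum]
      simp_rw [Finset.mul_sum]
    simp_rw [e2]
    calc _ = ∑ k, ∑ a, ∑ l, ∑ b, u a j * u b j * ((u a k * u b k) * (u a l * u b l)) :=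
          Finset.sum_congr rfl fun _ _ => Finset.sum_comm
      _ = ∑ a, ∑ k, ∑ l, ∑ b, u a j * u b j * ((u a k * u b k) * (u a l * u b l)) :=
          Finset.sum_comm
      _ = ∑ a, ∑ k, ∑ b, ∑ l, u a j * u b j * ((u a k * u b k) * (u a l * u b l)) :=
          Finset.sum_congr rfl fun _ _ => Finset.sum_congr rfl fun _ _ => Finset.sum_comm
      _ = _ := Finset.sum_congr rfl fun _ _ => Finset.sum_comm
  have hterm : ∀ a b, u a j * u b j * inp (u a) (u b) ^ 2
      ≤ (if a = b then c ^ 2 * lamMax u ^ 2 else 0) + c ^ 4 * lamMax u ^ 2 := by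
    intro a b
    have hprod : u a j * u b j ≤ (c * l2norm (u a)) * (c * l2norm (u b)) :=
      calc u a j * u b j ≤ |u a j * u b j| := le_abs_self _
        _ = |u a j| * |u b j| := abs_mul _ _
        _ ≤ _ := mul_le_mul (hu a) (hu b) (abs_nonneg _) (mul_nonneg hc0 (hs0 a))
    have hLL : l2norm (u a) ^ 3 * l2norm (u b) ^ 3 ≤ lamMax u * lamMax u :=
      mul_le_mul (hL a) (hL b) (pow_nonneg (hs0 b) 3) hL0
    have hnn : 0 ≤ (c * l2norm (u a)) * (c * l2norm (u b)) :=
      mul_nonneg (mul_nonneg hc0 (hs0 a)) (mul_nonneg hc0 (hs0 b))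
    have h1 := mul_le_mul_of_nonneg_right hprod (sq_nonneg (inp (u a) (u b)))
    refine h1.trans ?_
    by_cases hab : a = b
    · subst hab
      rw [if_pos rfl, hss]
      have h2 := mul_le_mul_of_nonneg_left hLL (sq_nonneg c)
      have h3 : 0 ≤ c ^ 4 * lamMax u ^ 2 := by positivity
      nlinarith [h2, h3]
    · rw [if_neg hab]
      have h2 : inp (u a) (u b) ^ 2 ≤ c ^ 2 * l2norm (u a) ^ 2 * l2norm (u b) ^ 2 := by
        have h := hincoh2 a b hab
        rw [← hc] at h
        refine le_of_mul_le_mul_left ?_ hd'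
        linarith
      have h3 := mul_le_mul_of_nonneg_left h2 hnn
      have h4 := mul_le_mul_of_nonneg_left hLL (pow_nonneg hc0 4)
      nlinarith [h3, h4]
  have hrc : c ^ 2 * r ≤ 1 := by
    refine le_of_mul_le_mul_left ?_ hd'
    rw [← hc] at hμr
    linarith
  have hfin : 2 * μ * r * lamMax u ^ 2 / d = 2 * (c ^ 2 * r) * lamMax u ^ 2 := by
    rw [← hc]
    field_simp
  rw [hsum, hfin]
  refine (Finset.sum_le_sum fun a _ => Finset.sum_le_sum fun b _ => hterm a b).trans ?_
  simp only [Finset.sum_add_distrib, Finset.sum_ite_eq, Finset.mem_univ, if_true,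
    Finset.sum_const, Finset.card_univ, Fintype.card_fin, nsmul_eq_mul]
  have h5 : (c ^ 2 * r) * (c ^ 2 * r) ≤ (c ^ 2 * r) * 1 :=
    mul_le_mul_of_nonneg_left hrc (by positivity)
  have h6 := mul_le_mul_of_nonneg_right h5 (sq_nonneg (lamMax u))
  nlinarith [h6]
end

section
/- Let d, r be positive integers, u_1, …, u_r ∈ ℝ^d, μ ≥ 1, and T⋆ = Σ_{i=1}^r u_i^{⊗3}. Assume d‖u_i‖_∞² ≤ μ‖u_i‖₂² for every i, d⟨u_i, u_j⟩² ≤ μ‖u_i‖₂²‖u_j‖₂² for all i ≠ j, and r·√(μ/d) ≤ 1. Then for every pair of indices (k, l) ∈ {1, …, d}², one has Σ_{j=1}^d (T⋆_{j,k,l})² ≤ 2μ²r·λ_max⋆²/d². -/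
open MeasureTheory ProbabilityTheory

/-- Under the incoherence assumptions and r√(μ/d) ≤ 1, every mode-1 column of
T⋆ = Σᵢ uᵢ^{⊗3} has squared ℓ₂ norm at most 2μ²r·λ_max⋆²/d². -/
theorem stmt3 (d r : ℕ) (hd : 0 < d) (hr : 0 < r)
    (u : Fin r → Fin d → ℝ)
    (μ : ℝ) (hμ : 1 ≤ μ)
    (hincoh1 : ∀ i, (d : ℝ) * linfnorm (u i) ^ 2 ≤ μ * l2norm (u i) ^ 2)
    (hincoh2 : ∀ i j : Fin r, i ≠ j →
      (d : ℝ) * inp (u i) (u j) ^ 2 ≤ μ * l2norm (u i) ^ 2 * l2norm (u j) ^ 2)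
    (hrank : (r : ℝ) * Real.sqrt (μ / d) ≤ 1) :
    ∀ k l : Fin d, ∑ j, Tstar u j k l ^ 2 ≤ 2 * μ ^ 2 * r * lamMax u ^ 2 / (d : ℝ) ^ 2 := by
  intro k l
  have hd' : (0 : ℝ) < d := by exact_mod_cast hd
  obtain ⟨s, hs⟩ : ∃ s, s = Real.sqrt (μ / d) := ⟨_, rfl⟩
  have hs0 : 0 ≤ s := hs ▸ Real.sqrt_nonneg _
  have hs2 : s ^ 2 = μ / d := by
    rw [hs]; exact Real.sq_sqrt (by positivity)
  have hμs : μ = s ^ 2 * d := by rw [hs2]; field_simp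
  rw [← hs] at hrank
  have hn0 : ∀ i, 0 ≤ l2norm (u i) := fun i => Real.sqrt_nonneg _
  have hL : ∀ i, l2norm (u i) ^ 3 ≤ lamMax u := fun i =>
    le_ciSup (f := fun i => l2norm (u i) ^ 3) (Set.finite_range _).bddAbove i
  have hL0 : 0 ≤ lamMax u := le_trans (pow_nonneg (hn0 ⟨0, hr⟩) 3) (hL ⟨0, hr⟩)
  have hent : ∀ i j, |u i j| ≤ s * l2norm (u i) := by
    intro i j
    have h1 : |u i j| ≤ linfnorm (u i) :=
      le_ciSup (f := fun j => |u i j|) (Set.finite_range _).bddAbove j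
    have h2 := hincoh1 i
    have h3 : linfnorm (u i) ^ 2 ≤ (s * l2norm (u i)) ^ 2 := by
      refine le_of_mul_le_mul_left ?_ hd'
      rw [hμs] at h2
      calc _ ≤ _ := h2
        _ = _ := by ring
    exact h1.trans (le_of_sq_le_sq h3 (mul_nonneg hs0 (hn0 i)))
  have hinp : ∀ i j, |inp (u i) (u j)| ≤
      (l2norm (u i) * l2norm (u j)) * ((if i = j then 1 else 0) + s) := by
    intro i j
    by_cases hij : i = j
    · subst hij
      have h1 : inp (u i) (u i) = l2norm (u i) ^ 2 := by
        unfold inp l2norm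
        rw [Real.sq_sqrt (Finset.sum_nonneg fun _ _ => sq_nonneg _)]
        exact Finset.sum_congr rfl fun _ _ => by ring
      rw [h1, abs_of_nonneg (sq_nonneg _), if_pos rfl]
      nlinarith [mul_nonneg hs0 (sq_nonneg (l2norm (u i)))]
    · rw [if_neg hij, zero_add]
      have h2 := hincoh2 i j hij
      apply abs_le_of_sq_le_sq _ (mul_nonneg (mul_nonneg (hn0 i) (hn0 j)) hs0)
      refine le_of_mul_le_mul_left ?_ hd'
      rw [hμs] at h2
      calc _ ≤ _ := h2
        _ = _ := by ring
  have hexp : ∑ j, Tstar u j k l ^ 2 =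
      ∑ i, ∑ i', (u i k * u i l) * (u i' k * u i' l) * inp (u i) (u i') := by
    unfold Tstar inp
    simp_rw [sq, Finset.sum_mul_sum, Finset.mul_sum]
    rw [Finset.sum_comm]
    refine Finset.sum_congr rfl fun i _ => ?_
    rw [Finset.sum_comm]
    refine Finset.sum_congr rfl fun i' _ => Finset.sum_congr rfl fun j _ => by ring
  have hterm : ∀ i i', (u i k * u i l) * (u i' k * u i' l) * inp (u i) (u i') ≤
      s ^ 4 * lamMax u ^ 2 * ((if i = i' then 1 else 0) + s) := by
    intro i i'
    have hδ : (0 : ℝ) ≤ (if i = i' then 1 else 0) + s := by split_ifs <;> linarith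
    have a := hn0 i
    have b := hn0 i'
    calc _ ≤ |(u i k * u i l) * (u i' k * u i' l) * inp (u i) (u i')| := le_abs_self _
      _ = (|u i k| * |u i l|) * (|u i' k| * |u i' l|) * |inp (u i) (u i')| := by
        simp only [abs_mul]
      _ ≤ ((s * l2norm (u i)) * (s * l2norm (u i))) *
          ((s * l2norm (u i')) * (s * l2norm (u i'))) *
          ((l2norm (u i) * l2norm (u i')) * ((if i = i' then 1 else 0) + s)) := by
        gcongr <;> first | apply hent | apply hinp
      _ = s ^ 4 * (l2norm (u i) ^ 3 * l2norm (u i') ^ 3) *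
          ((if i = i' then 1 else 0) + s) := by ring
      _ ≤ s ^ 4 * (lamMax u * lamMax u) * ((if i = i' then 1 else 0) + s) := by
        gcongr <;> apply hL
      _ = _ := by ring
  calc ∑ j, Tstar u j k l ^ 2 
      ≤ ∑ i : Fin r, ∑ i' : Fin r, 
          s ^ 4 * lamMax u ^ 2 * ((if i = i' then 1 else 0) + s) := by
        rw [hexp]
        exact Finset.sum_le_sum fun i _ => Finset.sum_le_sum fun i' _ => hterm i i'
    _ = s ^ 4 * lamMax u ^ 2 * (r * (1 + r * s)) := by
        simp [← Finset.mul_sum, Finset.sum_add_distrib]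
        ring
    _ ≤ s ^ 4 * lamMax u ^ 2 * (r * (1 + 1)) := by gcongr
    _ = _ := by
        rw [hμs]; field_simp; ring
end

section
/- There exist universal constants c > 0 and C > 0 with the following property. Let d, r be positive integers, u_1, …, u_r ∈ ℝ^d nonzero vectors, μ ≥ 1, T⋆ = Σ_{i=1}^r u_i^{⊗3}, and U⋆ = [u_1, …, u_r] ∈ ℝ^{d×r}. Assume d⟨u_i, u_j⟩² ≤ μ‖u_i‖₂²‖u_j‖₂² for all i ≠ j and r·√(μ/d) ≤ c·(λ_min⋆/λ_max⋆)². If 0 ≤ δ ≤ c/r and U' = [u'_1, …, u'_r] ∈ ℝ^{d×r} satisfies ‖U' − U⋆‖_F ≤ δ‖U⋆‖_F, then the tensor T = Σ_{i=1}^r (u'_i)^{⊗3} satisfies ‖T − T⋆‖_F ≤ C·(λ_max⋆/λ_min⋆)·δ·‖T⋆‖_F. -/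
open MeasureTheory ProbabilityTheory

open Finset in
theorem aux_gram {d r : ℕ} (x y z : Fin r → Fin d → ℝ) :
    ∑ j, ∑ k, ∑ l, (∑ i, x i j * y i k * z i l) ^ 2 =
      ∑ i, ∑ i', inp (x i) (x i') * inp (y i) (y i') * inp (z i) (z i') := by
  have h : ∀ j k l, (∑ i, x i j * y i k * z i l) ^ 2 =
      ∑ i, ∑ i', (x i j * x i' j) * (y i k * y i' k) * (z i l * z i' l) := by
    intro j k l
    rw [sq, Finset.sum_mul_sum]
    refine sum_congr rfl fun i _ => sum_congr rfl fun i' _ => by ring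
  have h2 : ∀ i i', inp (x i) (x i') * inp (y i) (y i') * inp (z i) (z i') =
      ∑ j, ∑ k, ∑ l, (x i j * x i' j) * (y i k * y i' k) * (z i l * z i' l) := by
    intro i i'
    simp only [← Finset.mul_sum, ← Finset.sum_mul, inp]
  simp only [h, h2]
  calc _ = ∑ j, ∑ k, ∑ i, ∑ l, ∑ i', (x i j * x i' j) * (y i k * y i' k) * (z i l * z i' l) := by
        refine sum_congr rfl fun j _ => sum_congr rfl fun k _ => sum_comm
    _ = ∑ j, ∑ i, ∑ k, ∑ l, ∑ i', (x i j * x i' j) * (y i k * y i' k) * (z i l * z i' l) := by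
        refine sum_congr rfl fun j _ => sum_comm
    _ = ∑ i, ∑ j, ∑ k, ∑ l, ∑ i', (x i j * x i' j) * (y i k * y i' k) * (z i l * z i' l) := sum_comm
    _ = ∑ i, ∑ j, ∑ k, ∑ i', ∑ l, (x i j * x i' j) * (y i k * y i' k) * (z i l * z i' l) := by
        refine sum_congr rfl fun i _ => sum_congr rfl fun j _ => sum_congr rfl fun k _ => sum_comm
    _ = ∑ i, ∑ j, ∑ i', ∑ k, ∑ l, (x i j * x i' j) * (y i k * y i' k) * (z i l * z i' l) := by
        refine sum_congr rfl fun i _ => sum_congr rfl fun j _ => sum_comm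
    _ = _ := by
        refine sum_congr rfl fun i _ => sum_comm

theorem aux_cs {d : ℕ} (x y : Fin d → ℝ) : inp x y ^ 2 ≤ inp x x * inp y y := by
  unfold inp
  simpa [sq] using Finset.sum_mul_sq_le_sq_mul_sq Finset.univ x y

theorem aux_inp_nonneg {d : ℕ} (x : Fin d → ℝ) : 0 ≤ inp x x :=
  Finset.sum_nonneg fun j _ => mul_self_nonneg _

theorem aux_l2sq {d : ℕ} (x : Fin d → ℝ) : l2norm x ^ 2 = inp x x := by
  unfold l2norm inp
  rw [Real.sq_sqrt (Finset.sum_nonneg fun j _ => sq_nonneg _)]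
  simp [sq]

theorem aux_frobM {d r : ℕ} (x : Fin r → Fin d → ℝ) : frobM x ^ 2 = ∑ i, inp (x i) (x i) := by
  unfold frobM inp
  rw [Real.sq_sqrt (Finset.sum_nonneg fun i _ => Finset.sum_nonneg fun j _ => sq_nonneg _)]
  simp [sq]

theorem aux_frobT {d : ℕ} (T : Fin d → Fin d → Fin d → ℝ) :
    frobT T ^ 2 = ∑ j, ∑ k, ∑ l, T j k l ^ 2 := by
  unfold frobT
  rw [Real.sq_sqrt]
  positivity

theorem aux_am {d : ℕ} (x y : Fin d → ℝ) : |inp x y| ≤ (inp x x + inp y y) / 2 := by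
  apply abs_le_of_sq_le_sq
  · nlinarith [aux_cs x y, sq_nonneg (inp x x - inp y y)]
  · linarith [aux_inp_nonneg x, aux_inp_nonneg y]

theorem aux_dsum {r : ℕ} (f : Fin r → ℝ) (a b : ℝ) :
    ∑ i, ∑ j, ((if i = j then a * f i else 0) + b * ((f i + f j) / 2))
      = (a + r * b) * ∑ i, f i := by
  simp only [Finset.sum_add_distrib, ← Finset.mul_sum, ← Finset.sum_div]
  simp [Finset.sum_add_distrib, ← Finset.mul_sum]
  ring

/-- first-order terms -/
theorem aux_first {d r : ℕ} (u D : Fin r → Fin d → ℝ) (e M : ℝ)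
    (hM : ∀ i, inp (u i) (u i) ≤ M) (hM0 : 0 ≤ M)
    (hinc : ∀ i j, i ≠ j → inp (u i) (u j) ^ 2 ≤ e ^ 2 * (inp (u i) (u i) * inp (u j) (u j)))
    (hre : r * e ^ 2 ≤ 1) :
    ∑ i, ∑ j, inp (D i) (D j) * inp (u i) (u j) ^ 2 ≤ 2 * M ^ 2 * ∑ i, inp (D i) (D i) := by
  have key : ∀ i j, inp (D i) (D j) * inp (u i) (u j) ^ 2 ≤
      (if i = j then M ^ 2 * inp (D i) (D i) else 0)
        + (e ^ 2 * M ^ 2) * ((inp (D i) (D i) + inp (D j) (D j)) / 2) := by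
    intro i j
    have h0 := aux_inp_nonneg (D i)
    have h1 := aux_inp_nonneg (D j)
    have h2 := aux_inp_nonneg (u i)
    have h3 := aux_inp_nonneg (u j)
    have hpos : 0 ≤ (e ^ 2 * M ^ 2) * ((inp (D i) (D i) + inp (D j) (D j)) / 2) := by positivity
    have hNN : inp (u i) (u i) * inp (u j) (u j) ≤ M ^ 2 := by
      rw [sq]; exact mul_le_mul (hM i) (hM j) h3 hM0
    split_ifs with hij
    · subst hij
      have : inp (D i) (D i) * inp (u i) (u i) ^ 2 ≤ inp (D i) (D i) * M ^ 2 := by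
        apply mul_le_mul_of_nonneg_left _ h0
        nlinarith
      linarith
    · have h4 := hinc i j hij
      have h5 : inp (u i) (u j) ^ 2 ≤ e ^ 2 * M ^ 2 :=
        h4.trans (mul_le_mul_of_nonneg_left hNN (sq_nonneg e))
      have h6 := (le_abs_self _).trans (aux_am (D i) (D j))
      rw [zero_add]
      calc _ ≤ ((inp (D i) (D i) + inp (D j) (D j)) / 2) * inp (u i) (u j) ^ 2 :=
            mul_le_mul_of_nonneg_right h6 (sq_nonneg _)
        _ ≤ ((inp (D i) (D i) + inp (D j) (D j)) / 2) * (e ^ 2 * M ^ 2) :=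
            mul_le_mul_of_nonneg_left h5 (by positivity)
        _ = _ := by ring
  have hF : 0 ≤ ∑ i, inp (D i) (D i) := Finset.sum_nonneg fun i _ => aux_inp_nonneg _
  calc _ ≤ _ := Finset.sum_le_sum fun i _ => Finset.sum_le_sum fun j _ => key i j
    _ = (M ^ 2 + r * (e ^ 2 * M ^ 2)) * ∑ i, inp (D i) (D i) := aux_dsum _ _ _
    _ ≤ _ := by
      apply mul_le_mul_of_nonneg_right _ hF
      nlinarith [mul_le_mul_of_nonneg_right hre (sq_nonneg M)]

theorem aux_second {d r : ℕ} (v D : Fin r → Fin d → ℝ) (M : ℝ)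
    (hM : ∀ i, inp (v i) (v i) ≤ M) :
    ∑ i, ∑ j, inp (D i) (D j) ^ 2 * inp (v i) (v j) ≤ M * (∑ i, inp (D i) (D i)) ^ 2 := by
  have key : ∀ i j, inp (D i) (D j) ^ 2 * inp (v i) (v j) ≤
      M * (inp (D i) (D i) * inp (D j) (D j)) := by
    intro i j
    have h0 := aux_inp_nonneg (D i)
    have h1 := aux_inp_nonneg (D j)
    have h6 : inp (v i) (v j) ≤ M := by
      linarith [(le_abs_self _).trans (aux_am (v i) (v j)), hM i, hM j]
    have hM0 : 0 ≤ M := (aux_inp_nonneg (v i)).trans (hM i)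
    calc _ ≤ inp (D i) (D j) ^ 2 * M := mul_le_mul_of_nonneg_left h6 (sq_nonneg _)
      _ ≤ (inp (D i) (D i) * inp (D j) (D j)) * M :=
        mul_le_mul_of_nonneg_right (aux_cs _ _) hM0
      _ = _ := by ring
  calc _ ≤ _ := Finset.sum_le_sum fun i _ => Finset.sum_le_sum fun j _ => key i j
    _ = _ := by
      rw [sq, Finset.sum_mul_sum]
      simp only [Finset.mul_sum]

theorem aux_lower {d r : ℕ} (u : Fin r → Fin d → ℝ) (e : ℝ) (he : 0 ≤ e)
    (hinc : ∀ i j, i ≠ j → inp (u i) (u j) ^ 2 ≤ e ^ 2 * (inp (u i) (u i) * inp (u j) (u j)))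
    (hre : r * e ^ 3 ≤ 1 / 2) :
    (∑ i, inp (u i) (u i) ^ 3) / 2 ≤ ∑ i, ∑ j, inp (u i) (u j) ^ 3 := by
  have key : ∀ i j, (if i = j then 1 * inp (u i) (u i) ^ 3 else 0)
        + (- e ^ 3) * ((inp (u i) (u i) ^ 3 + inp (u j) (u j) ^ 3) / 2) ≤
        inp (u i) (u j) ^ 3 := by
    intro i j
    have h2 := aux_inp_nonneg (u i)
    have h3 := aux_inp_nonneg (u j)
    split_ifs with hij
    · subst hij
      have : 0 ≤ e ^ 3 * inp (u i) (u i) ^ 3 := by positivity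
      linarith
    · have h4 := hinc i j hij
      have ha : 0 ≤ l2norm (u i) := Real.sqrt_nonneg _
      have hb : 0 ≤ l2norm (u j) := Real.sqrt_nonneg _
      rw [← aux_l2sq (u i), ← aux_l2sq (u j)] at *
      set a := l2norm (u i)
      set b := l2norm (u j)
      have h5 : |inp (u i) (u j)| ≤ e * (a * b) := by
        apply abs_le_of_sq_le_sq _ (by positivity)
        calc _ ≤ _ := h4
          _ = _ := by ring
      have h6 : |inp (u i) (u j)| ^ 3 ≤ (e * (a * b)) ^ 3 := pow_le_pow_left₀ (abs_nonneg _) h5 3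
      rw [← abs_pow] at h6
      have h7 := neg_abs_le (inp (u i) (u j) ^ 3)
      have h8 : 0 ≤ e ^ 3 * (a ^ 3 - b ^ 3) ^ 2 := by positivity
      nlinarith
  have hP : 0 ≤ ∑ i, inp (u i) (u i) ^ 3 :=
    Finset.sum_nonneg fun i _ => pow_nonneg (aux_inp_nonneg _) 3
  calc _ ≤ (1 + r * (- e ^ 3)) * ∑ i, inp (u i) (u i) ^ 3 := by nlinarith
    _ = _ := (aux_dsum _ _ _).symm
    _ ≤ _ := Finset.sum_le_sum fun i _ => Finset.sum_le_sum fun j _ => key i j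

theorem aux_expand {d r : ℕ} (u u' D : Fin r → Fin d → ℝ) (hD : ∀ i j, D i j = u' i j - u i j) :
    frobT (fun j k l => Tstar u' j k l - Tstar u j k l) ^ 2 ≤
      7 * (3 * (∑ i, ∑ j, inp (D i) (D j) * inp (u i) (u j) ^ 2)
        + 3 * (∑ i, ∑ j, inp (D i) (D j) ^ 2 * inp (u i) (u j))
        + ∑ i, ∑ j, inp (D i) (D j) ^ 2 * inp (D i) (D j)) := by
  have e1 := aux_gram D u u
  have e2 := aux_gram u D u
  have e3 := aux_gram u u D
  have e4 := aux_gram D D u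
  have e5 := aux_gram D u D
  have e6 := aux_gram u D D
  have e7 := aux_gram D D D
  have p : ∀ j k l, (Tstar u' j k l - Tstar u j k l) ^ 2 ≤
      7 * ((∑ i, D i j * u i k * u i l) ^ 2 + (∑ i, u i j * D i k * u i l) ^ 2
        + (∑ i, u i j * u i k * D i l) ^ 2 + (∑ i, D i j * D i k * u i l) ^ 2
        + (∑ i, D i j * u i k * D i l) ^ 2 + (∑ i, u i j * D i k * D i l) ^ 2
        + (∑ i, D i j * D i k * D i l) ^ 2) := by
    intro j k l
    have : Tstar u' j k l - Tstar u j k l =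
      (∑ i, D i j * u i k * u i l) + (∑ i, u i j * D i k * u i l)
        + (∑ i, u i j * u i k * D i l) + (∑ i, D i j * D i k * u i l)
        + (∑ i, D i j * u i k * D i l) + (∑ i, u i j * D i k * D i l)
        + (∑ i, D i j * D i k * D i l) := by
      unfold Tstar
      simp only [← Finset.sum_add_distrib, ← Finset.sum_sub_distrib]
      refine Finset.sum_congr rfl fun i _ => ?_
      simp only [hD]; ring
    rw [this]
    generalize (∑ i, D i j * u i k * u i l) = x1
    generalize (∑ i, u i j * D i k * u i l) = x2
    generalize (∑ i, u i j * u i k * D i l) = x3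
    generalize (∑ i, D i j * D i k * u i l) = x4
    generalize (∑ i, D i j * u i k * D i l) = x5
    generalize (∑ i, u i j * D i k * D i l) = x6
    generalize (∑ i, D i j * D i k * D i l) = x7
    have := sq_sum_le_card_mul_sum_sq (s := (Finset.univ : Finset (Fin 7)))
      (f := ![x1, x2, x3, x4, x5, x6, x7])
    simp [Fin.sum_univ_succ] at this
    linarith
  rw [aux_frobT]
  have q := Finset.sum_le_sum fun j (_ : j ∈ Finset.univ) => Finset.sum_le_sum
    fun k (_ : k ∈ Finset.univ) => Finset.sum_le_sum fun l (_ : l ∈ Finset.univ) => p j k l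
  refine q.trans (le_of_eq ?_)
  simp only [← Finset.mul_sum, Finset.sum_add_distrib]
  rw [e1, e2, e3, e4, e5, e6, e7]
  have f2 : ∑ i, ∑ i', inp (u i) (u i') * inp (D i) (D i') * inp (u i) (u i') =
    ∑ i, ∑ j, inp (D i) (D j) * inp (u i) (u j) ^ 2 :=
    Finset.sum_congr rfl fun i _ => Finset.sum_congr rfl fun j _ => by ring
  have f1 : ∑ i, ∑ i', inp (D i) (D i') * inp (u i) (u i') * inp (u i) (u i') =
    ∑ i, ∑ j, inp (D i) (D j) * inp (u i) (u j) ^ 2 :=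
    Finset.sum_congr rfl fun i _ => Finset.sum_congr rfl fun j _ => by ring
  have f3 : ∑ i, ∑ i', inp (u i) (u i') * inp (u i) (u i') * inp (D i) (D i') =
    ∑ i, ∑ j, inp (D i) (D j) * inp (u i) (u j) ^ 2 :=
    Finset.sum_congr rfl fun i _ => Finset.sum_congr rfl fun j _ => by ring
  have f4 : ∑ i, ∑ i', inp (D i) (D i') * inp (D i) (D i') * inp (u i) (u i') =
    ∑ i, ∑ j, inp (D i) (D j) ^ 2 * inp (u i) (u j) :=
    Finset.sum_congr rfl fun i _ => Finset.sum_congr rfl fun j _ => by ring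
  have f5 : ∑ i, ∑ i', inp (D i) (D i') * inp (u i) (u i') * inp (D i) (D i') =
    ∑ i, ∑ j, inp (D i) (D j) ^ 2 * inp (u i) (u j) :=
    Finset.sum_congr rfl fun i _ => Finset.sum_congr rfl fun j _ => by ring
  have f6 : ∑ i, ∑ i', inp (u i) (u i') * inp (D i) (D i') * inp (D i) (D i') =
    ∑ i, ∑ j, inp (D i) (D j) ^ 2 * inp (u i) (u j) :=
    Finset.sum_congr rfl fun i _ => Finset.sum_congr rfl fun j _ => by ring
  have f7 : ∑ i, ∑ i', inp (D i) (D i') * inp (D i) (D i') * inp (D i) (D i') =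
    ∑ i, ∑ j, inp (D i) (D j) ^ 2 * inp (D i) (D j) :=
    Finset.sum_congr rfl fun i _ => Finset.sum_congr rfl fun j _ => by ring
  rw [f1, f2, f3, f4, f5, f6, f7]
  ring

set_option maxHeartbeats 2000000 in
/-- Frobenius-norm Lipschitz-type stability of U ↦ Σᵢ uᵢ^{⊗3}: there are
universal constants c, C > 0 such that if ‖U' − U⋆‖_F ≤ δ‖U⋆‖_F with δ ≤ c/r, then
‖T − T⋆‖_F ≤ C·(λ_max⋆/λ_min⋆)·δ·‖T⋆‖_F. -/
theorem stmt7 : ∃ c C : ℝ, 0 < c ∧ 0 < C ∧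
    ∀ (d r : ℕ), 0 < d → 0 < r →
    ∀ (u : Fin r → Fin d → ℝ), (∀ i, u i ≠ 0) →
    ∀ (μ : ℝ), 1 ≤ μ →
    (∀ i j : Fin r, i ≠ j →
      (d : ℝ) * inp (u i) (u j) ^ 2 ≤ μ * l2norm (u i) ^ 2 * l2norm (u j) ^ 2) →
    (r : ℝ) * Real.sqrt (μ / d) ≤ c * (lamMin u / lamMax u) ^ 2 →
    ∀ (δ : ℝ), 0 ≤ δ → δ ≤ c / r →
    ∀ (u' : Fin r → Fin d → ℝ),
    frobM (fun i j => u' i j - u i j) ≤ δ * frobM u →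
    frobT (fun j k l => Tstar u' j k l - Tstar u j k l) ≤
      C * (lamMax u / lamMin u) * δ * frobT (Tstar u) := by
  refine ⟨1 / 2, 12, by norm_num, by norm_num, ?_⟩
  intro d r hd hr u hu μ hμ hinc hr1 δ hδ0 hδ u' hU
  have : Nonempty (Fin r) := ⟨⟨0, hr⟩⟩
  obtain ⟨i0, hi0⟩ := Finite.exists_max (fun i => l2norm (u i))
  obtain ⟨i1, hi1⟩ := Finite.exists_min (fun i => l2norm (u i))
  have hn0 : ∀ i, 0 ≤ l2norm (u i) := fun i => Real.sqrt_nonneg _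
  have hmax : lamMax u = l2norm (u i0) ^ 3 := by
    unfold lamMax
    apply le_antisymm
    · exact ciSup_le fun i => pow_le_pow_left₀ (hn0 i) (hi0 i) 3
    · exact le_ciSup (f := fun i => l2norm (u i) ^ 3) (Set.finite_range _).bddAbove i0
  have hmin : lamMin u = l2norm (u i1) ^ 3 := by
    unfold lamMin
    apply le_antisymm
    · exact ciInf_le (f := fun i => l2norm (u i) ^ 3) (Set.finite_range _).bddBelow i1
    · exact le_ciInf fun i => pow_le_pow_left₀ (hn0 i1) (hi1 i) 3
  have hm : 0 < l2norm (u i1) := by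
    apply Real.sqrt_pos.mpr
    obtain ⟨j, hj⟩ := Function.ne_iff.mp (hu i1)
    have hj' : u i1 j ≠ 0 := hj
    exact Finset.sum_pos' (fun j _ => sq_nonneg _) ⟨j, Finset.mem_univ _, by positivity⟩
  rw [hmax, hmin] at hr1 ⊢
  have hmM : l2norm (u i1) ≤ l2norm (u i0) := hi0 i1
  generalize hmdef : l2norm (u i1) = m at *
  generalize hMdef : l2norm (u i0) = M at *
  have hM : 0 < M := hm.trans_le hmM
  have hd' : (0 : ℝ) < d := by exact_mod_cast hd
  have hr' : (1 : ℝ) ≤ r := by exact_mod_cast hr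
  -- incoherence
  set e := Real.sqrt (μ / d) with he
  have he0 : 0 ≤ e := Real.sqrt_nonneg _
  have hesq : e ^ 2 = μ / d := Real.sq_sqrt (by positivity)
  have hinc' : ∀ i j, i ≠ j →
      inp (u i) (u j) ^ 2 ≤ e ^ 2 * (inp (u i) (u i) * inp (u j) (u j)) := by
    intro i j hij
    have h := hinc i j hij
    rw [aux_l2sq, aux_l2sq] at h
    rw [hesq, div_mul_eq_mul_div, le_div_iff₀ hd']
    linarith
  have hratio : (m ^ 3 / M ^ 3) ^ 2 ≤ 1 := by
    apply pow_le_one₀ (by positivity)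
    rw [div_le_one (by positivity)]
    exact pow_le_pow_left₀ hm.le hmM 3
  have hre : r * e ≤ 1 / 2 := by linarith
  have hehalf : e ≤ 1 / 2 := by nlinarith
  have hre2 : r * e ^ 2 ≤ 1 := by nlinarith
  have hre3 : r * e ^ 3 ≤ 1 / 2 := by nlinarith [sq_nonneg e]
  have hNM : ∀ i, inp (u i) (u i) ≤ M ^ 2 := by
    intro i
    rw [← aux_l2sq]
    exact pow_le_pow_left₀ (hn0 i) (hi0 i) 2
  have hNm : ∀ i, m ^ 2 ≤ inp (u i) (u i) := by
    intro i
    rw [← aux_l2sq]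
    exact pow_le_pow_left₀ hm.le (hi1 i) 2
  -- abbreviations
  set D : Fin r → Fin d → ℝ := fun i j => u' i j - u i j with hDdef
  have hexp := aux_expand u u' D (fun i j => rfl)
  have hfirst := aux_first u D e (M ^ 2) hNM (by positivity) hinc' hre2
  have hsecond := aux_second u D (M ^ 2) hNM
  have hthird := aux_second D D (∑ i, inp (D i) (D i)) (fun i =>
    Finset.single_le_sum (f := fun i => inp (D i) (D i))
      (fun i _ => aux_inp_nonneg _) (Finset.mem_univ i))
  have hlow := aux_lower u e he0 hinc' hre3
  have hT : frobT (Tstar u) ^ 2 = ∑ i, ∑ j, inp (u i) (u j) ^ 3 := by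
    rw [aux_frobT]
    unfold Tstar
    rw [aux_gram]
    exact Finset.sum_congr rfl fun i _ => Finset.sum_congr rfl fun j _ => by ring
  have hF : ∑ i, inp (D i) (D i) ≤ δ ^ 2 * ∑ i, inp (u i) (u i) := by
    rw [← aux_frobM, ← aux_frobM, ← mul_pow]
    exact pow_le_pow_left₀ (Real.sqrt_nonneg _) hU 2
  have hF0 : 0 ≤ ∑ i, inp (D i) (D i) := Finset.sum_nonneg fun i _ => aux_inp_nonneg _
  have hA : ∑ i, inp (u i) (u i) ≤ r * M ^ 2 := by
    calc _ ≤ ∑ i : Fin r, M ^ 2 := Finset.sum_le_sum fun i _ => hNM i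
      _ = _ := by simp
  have hPM : M ^ 6 ≤ ∑ i, inp (u i) (u i) ^ 3 := by
    have := Finset.single_le_sum (f := fun i => inp (u i) (u i) ^ 3)
      (fun i _ => pow_nonneg (aux_inp_nonneg _) 3) (Finset.mem_univ i0)
    rw [← aux_l2sq (u i0), hMdef] at this
    calc M ^ 6 = (M ^ 2) ^ 3 := by ring
      _ ≤ _ := this
  have hPA : m ^ 4 * ∑ i, inp (u i) (u i) ≤ ∑ i, inp (u i) (u i) ^ 3 := by
    rw [Finset.mul_sum]
    refine Finset.sum_le_sum fun i _ => ?_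
    have h := pow_le_pow_left₀ (by positivity) (hNm i) 2
    calc _ = (m ^ 2) ^ 2 * inp (u i) (u i) := by ring
      _ ≤ inp (u i) (u i) ^ 2 * inp (u i) (u i) :=
        mul_le_mul_of_nonneg_right h (aux_inp_nonneg _)
      _ = _ := by ring
  rw [← hT] at hlow
  generalize (∑ i, ∑ j, inp (D i) (D j) * inp (u i) (u j) ^ 2) = S1 at *
  generalize (∑ i, ∑ j, inp (D i) (D j) ^ 2 * inp (u i) (u j)) = S2 at *
  generalize (∑ i, ∑ j, inp (D i) (D j) ^ 2 * inp (D i) (D j)) = S3 at *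
  generalize (∑ i, inp (D i) (D i)) = F at *
  generalize (∑ i, inp (u i) (u i) ^ 3) = P at *
  generalize (∑ i, inp (u i) (u i)) = A at *
  have hδr : δ * r ≤ 1 := by
    have : δ * r ≤ 1 / 2 := by rwa [le_div_iff₀ (by linarith)] at hδ
    linarith
  have hδ1 : δ ≤ 1 := by nlinarith
  have hP0 : 0 < P := lt_of_lt_of_le (by positivity) hPM
  have hFM : F ≤ δ * M ^ 2 := by
    calc F ≤ δ ^ 2 * (r * M ^ 2) := hF.trans (mul_le_mul_of_nonneg_left hA (sq_nonneg _))
      _ = (δ * r) * (δ * M ^ 2) := by ring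
      _ ≤ 1 * (δ * M ^ 2) := mul_le_mul_of_nonneg_right hδr (by positivity)
      _ = _ := one_mul _
  have b2 : S2 ≤ δ ^ 2 * P := by
    calc S2 ≤ M ^ 2 * F ^ 2 := hsecond
      _ ≤ M ^ 2 * (δ * M ^ 2) ^ 2 := by gcongr
      _ = δ ^ 2 * M ^ 6 := by ring
      _ ≤ _ := by gcongr
  have b3 : S3 ≤ δ ^ 2 * P := by
    calc S3 ≤ F * F ^ 2 := hthird
      _ ≤ (δ * M ^ 2) * (δ * M ^ 2) ^ 2 := by gcongr
      _ = δ * (δ ^ 2 * M ^ 6) := by ring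
      _ ≤ 1 * (δ ^ 2 * M ^ 6) := by gcongr
      _ = δ ^ 2 * M ^ 6 := one_mul _
      _ ≤ _ := by gcongr
  have hq : 1 ≤ M / m := (one_le_div hm).mpr hmM
  have hκ : M ^ 3 / m ^ 3 = (M / m) ^ 3 := (div_pow _ _ _).symm
  rw [hκ]
  have hMm : M = (M / m) * m := by field_simp
  generalize M / m = q at *
  have b1 : S1 ≤ 2 * q ^ 6 * (δ ^ 2 * P) := by
    calc S1 ≤ 2 * (M ^ 2) ^ 2 * F := hfirst
      _ ≤ 2 * (M ^ 2) ^ 2 * (δ ^ 2 * A) := by gcongr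
      _ = 2 * q ^ 4 * (δ ^ 2 * (m ^ 4 * A)) := by rw [hMm]; ring
      _ ≤ 2 * q ^ 4 * (δ ^ 2 * P) := by gcongr
      _ ≤ 2 * q ^ 6 * (δ ^ 2 * P) := by gcongr <;> first | exact hq | norm_num
  have hTn : 0 ≤ frobT (Tstar u) := Real.sqrt_nonneg _
  apply le_of_sq_le_sq _ (by positivity)
  have hq6 : 1 ≤ q ^ 6 := one_le_pow₀ hq
  have hw : 0 ≤ δ ^ 2 * P := by positivity
  have h1 : δ ^ 2 * P ≤ q ^ 6 * (δ ^ 2 * P) := le_mul_of_one_le_left hw hq6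
  calc _ ≤ _ := hexp
    _ ≤ 70 * (q ^ 6 * (δ ^ 2 * P)) := by linarith
    _ ≤ 70 * (q ^ 6 * (δ ^ 2 * (2 * frobT (Tstar u) ^ 2))) := by
      gcongr; linarith
    _ ≤ _ := by
      have : 0 ≤ q ^ 6 * δ ^ 2 * frobT (Tstar u) ^ 2 := by positivity
      nlinarith
end
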